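/- arXiv:1807.09292 — 2 statements merged into one kernel-verified Lean document; each statement's English description precedes it below -/
import Mathlib

section
/- In the warden's coin game with n coins (n ≥ 1), from every starting position x ∈ (Fin 2)^n the prisoner can force a win within n·2^n moves; that is, CanWin (n·2^n) x holds. -/
/-- One move: the rightmost entry is transferred to the far left, becoming `c`,
producing `(c, x₀, …, x_{n−2})`. -/
def shift {α : Type*} {n : ℕ} (c : α) (x : Fin n → α) : Fin n → α :=
  fun i => if _h : (i : ℕ) = 0 then c
    else x ⟨(i : ℕ) - 1, lt_of_le_of_lt (Nat.sub_le _ _) i.isLt⟩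

/-- The goal position: every die shows `m - 1`. -/
def goalPos (m n : ℕ) (hm : 1 ≤ m) : Fin n → Fin m :=
  fun _ => ⟨m - 1, Nat.sub_lt hm Nat.one_pos⟩

/-- `CanWin m n hm hn N x`: the prisoner can force the goal within `N` moves from
position `x`.  It holds iff `x` is the goal, or `N ≥ 1` and both:
(i) for every warden choice `c < x_{n-1}`, `CanWin (N-1)` holds at `(c, x₀, …, x_{n−2})`, and
(ii) there is a prisoner choice `c ≥ x_{n-1}` with `CanWin (N-1)` at `(c, x₀, …, x_{n−2})`. -/
def CanWin (m n : ℕ) (hm : 1 ≤ m) (hn : 1 ≤ n) : ℕ → (Fin n → Fin m) → Prop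
  | 0, x => x = goalPos m n hm
  | N + 1, x => x = goalPos m n hm ∨
      ((∀ c : Fin m, c < x ⟨n - 1, Nat.sub_lt hn Nat.one_pos⟩ →
          CanWin m n hm hn N (shift c x)) ∧
       ∃ c : Fin m, x ⟨n - 1, Nat.sub_lt hn Nat.one_pos⟩ ≤ c ∧
          CanWin m n hm hn N (shift c x))

theorem shift_snoc {α : Type*} {k : ℕ} (c b : α) (w : Fin k → α) :
    shift c (Fin.snoc w b : Fin (k + 1) → α) = Fin.cons c w := by
  funext i
  refine Fin.cases ?_ (fun j => ?_) i
  · simp [shift]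
  · have h := Fin.snoc_castSucc (α := fun _ => α) b w j
    simpa [shift, Fin.castSucc, Fin.castAdd, Fin.castLE] using h

/-- Summing over the words of length `k + 1` by splitting off the first letter gives the same
result as splitting off the last one. -/
theorem sum_snoc_eq_sum_cons {k : ℕ} (f : (Fin (k + 1) → Fin 2) → ℕ) :
    ∑ w : Fin k → Fin 2, (f (Fin.snoc w 0) + f (Fin.snoc w 1)) =
      ∑ w : Fin k → Fin 2, (f (Fin.cons 0 w) + f (Fin.cons 1 w)) := by
  have hs := Fintype.sum_equiv (Fin.snocEquiv fun _ : Fin (k + 1) => Fin 2)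
    (fun p => f (Fin.snoc p.2 p.1)) f fun _ => rfl
  have hc := Fintype.sum_equiv (Fin.consEquiv fun _ : Fin (k + 1) => Fin 2)
    (fun p => f (Fin.cons p.1 p.2)) f fun _ => rfl
  have h := hs.trans hc.symm
  rw [Fintype.sum_prod_type_right, Fintype.sum_prod_type_right] at h
  simpa [Fin.sum_univ_two] using h

/-- A nonempty set of positions in which the warden can stay forever contains the goal. -/
theorem one_mem_of_trap {k : ℕ} {T : Set (Fin (k + 1) → Fin 2)}
    (h₀ : ∀ w : Fin k → Fin 2, Fin.snoc w 0 ∈ T → ∀ c : Fin 2, Fin.cons c w ∈ T)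
    (h₁ : ∀ w : Fin k → Fin 2, Fin.snoc w 1 ∈ T → ∃ c : Fin 2, Fin.cons c w ∈ T)
    {x : Fin (k + 1) → Fin 2} (hx : x ∈ T) : (fun _ => 1) ∈ T := by
  classical
  let f : (Fin (k + 1) → Fin 2) → ℕ := fun y => if y ∈ T then 1 else 0
  -- In the de Bruijn graph every vertex has at least as many outgoing as incoming edges in `T`.
  have hle : ∀ w ∈ (Finset.univ : Finset (Fin k → Fin 2)),
      f (Fin.snoc w 0) + f (Fin.snoc w 1) ≤ f (Fin.cons 0 w) + f (Fin.cons 1 w) := by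
    intro w _
    have a := h₀ w
    have b := h₁ w
    simp only [Fin.forall_fin_two, Fin.exists_fin_two] at a b
    simp only [f]
    split_ifs <;> first | omega | tauto
  have heq := (Finset.sum_eq_sum_iff_of_le hle).1 (sum_snoc_eq_sum_cons f)
  have hback : ∀ (c : Fin 2) (w : Fin k → Fin 2), Fin.cons c w ∈ T → Fin.snoc w 1 ∈ T := by
    intro c w hc
    have e := heq w (Finset.mem_univ w)
    have a := h₀ w
    simp only [Fin.forall_fin_two] at a
    by_contra hn
    have hc' : Fin.cons 0 w ∈ T ∨ Fin.cons 1 w ∈ T := by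
      revert hc
      fin_cases c
      · exact Or.inl
      · exact Or.inr
    simp only [f] at e
    split_ifs at e <;> first | omega | tauto
  have hiter : ∀ j : ℕ,
      (fun i : Fin (k + 1) => if h : (i : ℕ) + j < k + 1 then x ⟨i + j, h⟩ else 1) ∈ T := by
    intro j
    induction j with
    | zero =>
      convert hx using 1
      funext i
      exact dif_pos i.isLt
    | succ j ih =>
      rw [← Fin.cons_self_tail (fun i : Fin (k + 1) => _)] at ih
      convert hback _ _ ih using 1
      funext i
      refine Fin.lastCases ?_ (fun i => ?_) i
      · simp
      · simp [Fin.tail, add_assoc, add_comm 1 j]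
  convert hiter (k + 1) using 1
  funext i
  rw [dif_neg (Nat.le_add_left (k + 1) i).not_gt]

section

variable {m n : ℕ} {hm : 1 ≤ m} {hn : 1 ≤ n}

theorem CanWin.succ {N : ℕ} {x : Fin n → Fin m} (h : CanWin m n hm hn N x) :
    CanWin m n hm hn (N + 1) x := by
  induction N generalizing x with
  | zero => exact Or.inl h
  | succ N ih =>
    rcases h with h | ⟨h, c, hc, hw⟩
    · exact Or.inl h
    · exact Or.inr ⟨fun c hc => ih (h c hc), c, hc, ih hw⟩

theorem CanWin.mono {M N : ℕ} (hMN : M ≤ N) {x : Fin n → Fin m}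
    (h : CanWin m n hm hn M x) : CanWin m n hm hn N x := by
  induction hMN with
  | refl => exact h
  | step _ ih => exact ih.succ

theorem canWin_goalPos (N : ℕ) : CanWin m n hm hn N (goalPos m n hm) :=
  CanWin.mono (Nat.zero_le N) (M := 0) rfl

end

/-- If one more move does not help, then the prisoner wins from everywhere. -/
theorem canWin_of_forall_succ {n : ℕ} {hm : 1 ≤ 2} {hn : 1 ≤ n} {N : ℕ}
    (h : ∀ x, CanWin 2 n hm hn (N + 1) x → CanWin 2 n hm hn N x) (x : Fin n → Fin 2) :
    CanWin 2 n hm hn N x := by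
  obtain ⟨k, rfl⟩ : ∃ k, n = k + 1 := ⟨n - 1, by omega⟩
  by_contra hx
  have hlast : ∀ (w : Fin k → Fin 2) (b : Fin 2),
      (Fin.snoc w b : Fin (k + 1) → Fin 2) ⟨k + 1 - 1, Nat.sub_lt hn Nat.one_pos⟩ = b :=
    fun w b => Fin.snoc_last (α := fun _ => Fin 2) b w
  refine one_mem_of_trap (T := {y | ¬ CanWin 2 (k + 1) hm hn N y}) ?_ ?_ hx (canWin_goalPos N)
  · intro w hw c hc
    refine hw (h _ (Or.inr ⟨fun d hd => ?_, c, ?_, ?_⟩))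
    · rw [hlast] at hd
      exact absurd hd (Fin.not_lt_zero d)
    · rw [hlast]
      exact Fin.zero_le c
    · rwa [shift_snoc]
  · intro w hw
    by_contra! hc
    simp only [Set.mem_ofPred_eq, not_not] at hc
    refine hw (h _ (Or.inr ⟨fun d _ => ?_, 1, ?_, ?_⟩))
    · rw [shift_snoc]
      exact hc d
    · rw [hlast]
    · rw [shift_snoc]
      exact hc 1

theorem canWin_or_lt_ncard {n : ℕ} {hm : 1 ≤ 2} {hn : 1 ≤ n} (N : ℕ) :
    (∀ x, CanWin 2 n hm hn N x) ∨ N < {x | CanWin 2 n hm hn N x}.ncard := by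
  induction N with
  | zero => exact Or.inr ((Set.ncard_pos).2 ⟨goalPos 2 n hm, canWin_goalPos (hn := hn) 0⟩)
  | succ N ih =>
    rcases ih with ih | ih
    · exact Or.inl fun x => (ih x).succ
    by_cases h : ∀ x, CanWin 2 n hm hn (N + 1) x → CanWin 2 n hm hn N x
    · exact Or.inl fun x => (canWin_of_forall_succ h x).succ
    · push Not at h
      obtain ⟨y, hy, hy'⟩ := h
      have hlt : {x | CanWin 2 n hm hn N x}.ncard < {x | CanWin 2 n hm hn (N + 1) x}.ncard :=
        Set.ncard_lt_ncard ⟨fun x hx => hx.succ, fun hs => hy' (hs hy)⟩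
      exact Or.inr (by omega)

/-- **Basic Win Strategy.** In the warden's coin game (`m = 2`) with `n ≥ 1` coins,
from every starting position the prisoner can force a win within `n * 2 ^ n` moves. -/
theorem warden_coins_win_within (n : ℕ) (hn : 1 ≤ n) (x : Fin n → Fin 2) :
    CanWin 2 n (by norm_num) hn (n * 2 ^ n) x := by
  refine CanWin.mono (Nat.le_mul_of_pos_left (2 ^ n) hn) ?_
  rcases canWin_or_lt_ncard (hm := by norm_num) (hn := hn) (2 ^ n) with h | h
  · exact h x
  · have hcard := Set.ncard_le_card {x | CanWin 2 n (by norm_num) hn (2 ^ n) x}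
    simp only [Nat.card_eq_fintype_card, Fintype.card_pi, Fintype.card_fin, Finset.prod_const,
      Finset.card_univ] at hcard
    omega
end

section
/- In the warden's game with n dice each having m sides (m ≥ 1, n ≥ 1), the starting remoteness of the goal position equals m^n; that is, r⁺(g) = m^n. -/
/-- The starting remoteness `r⁺(g)` of the goal position: the least `N ≥ 1` such that
(i) for every warden choice `c < m − 1`, `CanWin (N−1)` holds at `(c, m−1, …, m−1)`, and
(ii) `CanWin (N−1)` holds at `(m−1, m−1, …, m−1)` (the goal itself, the prisoner's
only choice `c ≥ m−1` being `c = m−1`). -/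
noncomputable def startRemoteness (m n : ℕ) (hm : 1 ≤ m) (hn : 1 ≤ n) : ℕ :=
  sInf {N | 1 ≤ N ∧
    (∀ c : Fin m, c < ⟨m - 1, Nat.sub_lt hm Nat.one_pos⟩ →
        CanWin m n hm hn (N - 1) (shift c (goalPos m n hm))) ∧
    CanWin m n hm hn (N - 1) (goalPos m n hm)}

theorem shift_eq_cons {α : Type*} {k : ℕ} (c : α) (x : Fin (k + 1) → α) :
    shift c x = (Fin.cons c (Fin.init x) : Fin (k + 1) → α) := by
  funext i
  refine Fin.cases ?_ (fun j => ?_) i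
  · simp [shift]
  · simp only [shift, Fin.val_succ, Fin.cons_succ, Fin.init]
    rw [dif_neg (by omega)]
    exact congrArg x (Fin.ext (by simp))

open Classical in
/-- The positions from which the prisoner can force the next position to lie in `S`. -/
noncomputable def forcing {m k : ℕ} (S : Finset (Fin (k + 1) → Fin m)) :
    Finset (Fin (k + 1) → Fin m) :=
  Finset.univ.filter fun x =>
    (∀ c < x (Fin.last k), shift c x ∈ S) ∧ ∃ c, x (Fin.last k) ≤ c ∧ shift c x ∈ S

theorem mem_forcing {m k : ℕ} {S : Finset (Fin (k + 1) → Fin m)} {x : Fin (k + 1) → Fin m} :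
    x ∈ forcing S ↔
      (∀ c < x (Fin.last k), shift c x ∈ S) ∧ ∃ c, x (Fin.last k) ≤ c ∧ shift c x ∈ S := by
  simp [forcing]

theorem forcing_mono {m k : ℕ} {S T : Finset (Fin (k + 1) → Fin m)} (h : S ⊆ T) :
    forcing S ⊆ forcing T := by
  intro x hx
  rw [mem_forcing] at hx ⊢
  obtain ⟨h₁, c, hc, h₂⟩ := hx
  exact ⟨fun d hd => h (h₁ d hd), c, hc, h h₂⟩

/-- If `x` ends in `a`, then `x ∈ forcing S` provides at least `a + 1` successors of `x` in `S`. -/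
theorem last_lt_card_tail_fiber {m k : ℕ} {S : Finset (Fin (k + 1) → Fin m)}
    {x : Fin (k + 1) → Fin m} (hx : x ∈ forcing S) :
    (x (Fin.last k) : ℕ) < (S.filter fun y => Fin.tail y = Fin.init x).card := by
  obtain ⟨h₁, c₀, hc₀, h₂⟩ := mem_forcing.1 hx
  have hinj : Function.Injective fun c => shift c x := fun c d h => by
    simpa [shift] using congrFun h 0
  have hsub : (insert c₀ (Finset.Iio (x (Fin.last k)))).image (fun c => shift c x) ⊆
      S.filter fun y => Fin.tail y = Fin.init x := by
    intro y hy
    obtain ⟨c, hc, rfl⟩ := Finset.mem_image.1 hy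
    rw [Finset.mem_filter]
    refine ⟨?_, by rw [shift_eq_cons, Fin.tail_cons]⟩
    rcases Finset.mem_insert.1 hc with rfl | hc
    · exact h₂
    · exact h₁ c (Finset.mem_Iio.1 hc)
  have hcard := Finset.card_le_card hsub
  rw [Finset.card_image_of_injective _ hinj,
    Finset.card_insert_of_notMem (by simpa using hc₀), Fin.card_Iio] at hcard
  omega

theorem card_forcing_le {m k : ℕ} (S : Finset (Fin (k + 1) → Fin m)) :
    (forcing S).card ≤ S.card := by
  rw [Finset.card_eq_sum_card_fiberwise (s := forcing S) (f := Fin.init (α := fun _ => Fin m))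
      (t := Finset.univ) (fun _ _ => Finset.mem_coe.2 (Finset.mem_univ _)),
    Finset.card_eq_sum_card_fiberwise (s := S) (f := Fin.tail (α := fun _ => Fin m))
      (t := Finset.univ) (fun _ _ => Finset.mem_coe.2 (Finset.mem_univ _))]
  refine Finset.sum_le_sum fun w _ => ?_
  rw [← Finset.card_range (S.filter fun y => Fin.tail y = w).card]
  refine Finset.card_le_card_of_injOn (fun x => (x (Fin.last k) : ℕ)) ?_ ?_
  · intro x hx
    obtain ⟨hxS, rfl⟩ := Finset.mem_filter.1 (Finset.mem_coe.1 hx)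
    exact Finset.mem_coe.2 (Finset.mem_range.2 (last_lt_card_tail_fiber hxS))
  · intro x hx y hy hxy
    have hx := (Finset.mem_filter.1 (Finset.mem_coe.1 hx)).2
    have hy := (Finset.mem_filter.1 (Finset.mem_coe.1 hy)).2
    rw [← Fin.snoc_init_self x, ← Fin.snoc_init_self y, hx, hy, Fin.ext hxy]

theorem toLex_lt_of_le_of_lt {m n : ℕ} {x z : Fin n → Fin m} {i : Fin n}
    (hle : ∀ j < i, z j ≤ x j) (hlt : z i < x i) : toLex z < toLex x := by
  by_contra h
  rcases (not_lt.1 h).eq_or_lt with h | ⟨j, hj, hxz⟩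
  · exact absurd (congrFun (toLex.injective h) i) hlt.ne'
  · rcases lt_trichotomy j i with hji | rfl | hij
    · exact (hle j hji).not_gt hxz
    · exact hlt.asymm hxz
    · exact hlt.ne' (hj i hij)

/-- The length `k + 1` window of the sequence `s` starting at index `t`. -/
def window {α : Type*} (k : ℕ) (s : ℕ → α) (t : ℕ) : Fin (k + 1) → α := fun i => s (t + i)

theorem shift_window {α : Type*} {k : ℕ} (s : ℕ → α) (t : ℕ) (c : α) :
    shift c (window k s (t + 1)) = window k (Function.update s t c) t := by
  funext i
  by_cases hi : (i : ℕ) = 0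
  · simp [shift, window, hi]
  · simp only [shift, window, hi, dif_neg, not_false_eq_true]
    rw [Function.update_of_ne (by omega)]
    congr 1
    omega

section Winning

variable {m k : ℕ} {S : Finset (Fin (k + 1) → Fin m)} {x : Fin (k + 1) → Fin m}

/-- Once the warden has lowered a die, copying every later die leads to a position
lexicographically below `x`. -/
theorem window_mem_of_lowered (hS : forcing S ⊆ S) (ih : ∀ z, toLex z < toLex x → z ∈ S)
    (i : Fin (k + 1)) (t : ℕ) (ht : t ≤ i) (s : ℕ → Fin m)
    (hx : ∀ j : Fin (k + 1), s (k + 1 + j) = x j)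
    (hle : ∀ j : Fin (k + 1), t ≤ j → j < i → s j ≤ x j) (hlt : s i < x i) :
    window k s t ∈ S := by
  induction t generalizing s with
  | zero =>
    refine ih _ (toLex_lt_of_le_of_lt (i := i) (fun j hj => ?_) ?_)
    · simpa [window] using hle j (Nat.zero_le _) hj
    · simpa [window] using hlt
  | succ t iht =>
    have hlast : window k s (t + 1) (Fin.last k) = x ⟨t, by omega⟩ := by
      rw [← hx]
      simp only [window, Fin.val_last]
      congr 1
      omega
    have copy : ∀ c ≤ x ⟨t, by omega⟩, shift c (window k s (t + 1)) ∈ S := by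
      intro c hc
      rw [shift_window]
      refine iht (by omega) _ (fun j => ?_) (fun j hj hji => ?_) ?_
      · rw [Function.update_of_ne (by omega), hx]
      · rcases hj.eq_or_lt with rfl | hj
        · simpa using hc
        · rw [Function.update_of_ne (by omega)]
          exact hle j hj hji
      · rwa [Function.update_of_ne (by omega)]
    refine hS (mem_forcing.2 ⟨fun c hc => copy c (hlast ▸ hc.le), x ⟨t, by omega⟩, hlast.le,
      copy _ le_rfl⟩)

/-- The prisoner always raises the die to its maximum until the warden lowers one. -/
theorem window_mem_of_raised (hS : forcing S ⊆ S) (ih : ∀ z, toLex z < toLex x → z ∈ S)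
    {M : Fin m} (hM : ∀ c, c ≤ M) (hg : (fun _ => M) ∈ S) (t : ℕ) (ht : t ≤ k + 1)
    (s : ℕ → Fin m) (hx : ∀ j : Fin (k + 1), s (k + 1 + j) = x j)
    (hs : ∀ j, t ≤ j → j < k + 1 → s j = M) : window k s t ∈ S := by
  induction t generalizing s with
  | zero =>
    convert hg using 1
    funext i
    exact hs _ (Nat.zero_le _) (by omega)
  | succ t iht =>
    have hlast : window k s (t + 1) (Fin.last k) = x ⟨t, by omega⟩ := by
      rw [← hx]
      simp only [window, Fin.val_last]
      congr 1
      omega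
    refine hS (mem_forcing.2 ⟨fun c hc => ?_, M, hM _, ?_⟩)
    · rw [shift_window]
      refine window_mem_of_lowered hS ih ⟨t, by omega⟩ t le_rfl _ (fun j => ?_)
        (fun j hj hji => absurd hji (not_lt.2 hj)) ?_
      · rw [Function.update_of_ne (by omega), hx]
      · simpa using hlast ▸ hc
    · rw [shift_window]
      refine iht (by omega) _ (fun j => ?_) (fun j hj hjk => ?_)
      · rw [Function.update_of_ne (by omega), hx]
      · rcases hj.eq_or_lt with rfl | hj
        · simp
        · rw [Function.update_of_ne (by omega)]
          exact hs j hj hjk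

end Winning

theorem eq_univ_of_forcing_subset {m k : ℕ} {S : Finset (Fin (k + 1) → Fin m)}
    (hS : forcing S ⊆ S) {M : Fin m} (hM : ∀ c, c ≤ M) (hg : (fun _ => M) ∈ S) :
    S = Finset.univ := by
  refine Finset.eq_univ_iff_forall.2 fun x => ?_
  have : WellFoundedLT (Lex (Fin (k + 1) → Fin m)) :=
    have : Finite (Lex (Fin (k + 1) → Fin m)) := inferInstanceAs (Finite (Fin (k + 1) → Fin m))
    Finite.to_wellFoundedLT
  suffices ∀ y : Lex (Fin (k + 1) → Fin m), ofLex y ∈ S from this (toLex x)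
  intro y
  induction y using WellFoundedLT.induction with
  | ind y ih =>
    let s : ℕ → Fin m := fun j =>
      if h : k + 1 ≤ j ∧ j - (k + 1) < k + 1 then ofLex y ⟨j - (k + 1), h.2⟩ else M
    have hx : ∀ j : Fin (k + 1), s (k + 1 + j) = ofLex y j := fun j => by
      have h : k + 1 ≤ k + 1 + (j : ℕ) ∧ k + 1 + (j : ℕ) - (k + 1) < k + 1 := by omega
      simp only [s, dif_pos h]
      exact congrArg (ofLex y) (Fin.ext (by simp))
    have := window_mem_of_raised hS (fun z hz => ih (toLex z) hz) hM hg (k + 1) le_rfl s hx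
      (fun j _ _ => by omega)
    convert this using 1
    funext j
    exact (hx j).symm

open Classical in
/-- The positions from which the prisoner can force the goal within `N` moves. -/
noncomputable def winSet (m k : ℕ) (hm : 1 ≤ m) : ℕ → Finset (Fin (k + 1) → Fin m)
  | 0 => {goalPos m (k + 1) hm}
  | N + 1 => insert (goalPos m (k + 1) hm) (forcing (winSet m k hm N))

section WinSet

variable {m k : ℕ} {hm : 1 ≤ m}

theorem mem_winSet {hn : 1 ≤ k + 1} {N : ℕ} {x : Fin (k + 1) → Fin m} :
    x ∈ winSet m k hm N ↔ CanWin m (k + 1) hm hn N x := by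
  induction N generalizing x with
  | zero => simp [winSet, CanWin]
  | succ N ih =>
    simp only [winSet, CanWin, Finset.mem_insert, mem_forcing, ih]
    rfl

theorem goalPos_mem_winSet (N : ℕ) : goalPos m (k + 1) hm ∈ winSet m k hm N := by
  cases N <;> simp [winSet]

theorem winSet_subset_succ (N : ℕ) : winSet m k hm N ⊆ winSet m k hm (N + 1) := by
  classical
  induction N with
  | zero => simp [winSet]
  | succ N ih => exact Finset.insert_subset_insert _ (forcing_mono ih)

theorem card_winSet_le (N : ℕ) : (winSet m k hm N).card ≤ N + 1 := by
  classical
  induction N with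
  | zero => simp [winSet]
  | succ N ih =>
    exact (Finset.card_insert_le _ _).trans (by have := card_forcing_le (winSet m k hm N); omega)

theorem winSet_eq_univ_of_succ_eq {N : ℕ} (h : winSet m k hm (N + 1) = winSet m k hm N) :
    winSet m k hm N = Finset.univ := by
  classical
  refine eq_univ_of_forcing_subset ?_ (M := ⟨m - 1, by omega⟩)
    (fun c => Fin.le_def.2 (by simp only; omega)) (goalPos_mem_winSet N)
  conv_rhs => rw [← h]
  exact Finset.subset_insert _ _

theorem min_le_card_winSet (N : ℕ) : min (N + 1) (m ^ (k + 1)) ≤ (winSet m k hm N).card := by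
  induction N with
  | zero => simp [winSet]
  | succ N ih =>
    rcases eq_or_ne (winSet m k hm (N + 1)) (winSet m k hm N) with h | h
    · rw [h, winSet_eq_univ_of_succ_eq h]
      simp
    · have := Finset.card_lt_card ((winSet_subset_succ N).ssubset_of_ne h.symm)
      omega

theorem winSet_eq_univ : winSet m k hm (m ^ (k + 1) - 1) = Finset.univ := by
  have hpos : 0 < m ^ (k + 1) := Nat.pow_pos hm
  have := min_le_card_winSet (k := k) (hm := hm) (m ^ (k + 1) - 1)
  refine Finset.eq_univ_of_card _ (le_antisymm (Finset.card_le_univ _) ?_)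
  simp only [Fintype.card_fun, Fintype.card_fin]
  omega

theorem goalPos_notMem_forcing {N : ℕ} (hN : N + 1 < m ^ (k + 1)) :
    goalPos m (k + 1) hm ∉ forcing (winSet m k hm N) := by
  classical
  intro h
  have h₁ := min_le_card_winSet (k := k) (hm := hm) (N + 1)
  have h₂ := card_winSet_le (k := k) (hm := hm) N
  have h₃ := card_forcing_le (winSet m k hm N)
  rw [winSet, Finset.insert_eq_of_mem h] at h₁
  omega

end WinSet

/-- The starting remoteness of the goal position equals `m ^ n`. -/
theorem startRemoteness_goal (m n : ℕ) (hm : 1 ≤ m) (hn : 1 ≤ n) :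
    startRemoteness m n hm hn = m ^ n := by
  obtain ⟨k, rfl⟩ : ∃ k, n = k + 1 := ⟨n - 1, by omega⟩
  refine IsLeast.csInf_eq ⟨⟨Nat.pow_pos hm, fun c _ => ?_, ?_⟩, ?_⟩
  · rw [← mem_winSet, winSet_eq_univ]
    exact Finset.mem_univ _
  · rw [← mem_winSet, winSet_eq_univ]
    exact Finset.mem_univ _
  · rintro N ⟨hN, hlow, hgoal⟩
    obtain ⟨N, rfl⟩ : ∃ M, N = M + 1 := ⟨N - 1, by omega⟩
    by_contra! hlt
    refine goalPos_notMem_forcing hlt (mem_forcing.2 ⟨fun c hc => mem_winSet.2 (hlow c hc),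
      ⟨m - 1, by omega⟩, le_rfl, ?_⟩)
    have hshift : shift ⟨m - 1, by omega⟩ (goalPos m (k + 1) hm) = goalPos m (k + 1) hm := by
      funext i
      simp [shift, goalPos]
    rw [hshift]
    exact mem_winSet.2 hgoal
end
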